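/- arXiv:0905.2259 — 2 statements merged into one kernel-verified Lean document; each statement's English description precedes it below -/
import Mathlib

section
/- If the state space $S$ is finite with $N$ elements and $(C_n)$ is an irreducible, aperiodic, reversible Markov chain without loops and with invariant probability $\pi$, then the limiting distribution of the mouse location in the cat-and-mouse chain is $\mathbb{P}(M_\infty=y)=(1-\pi(y))/(N-1)$ for each $y\in S$. -/
open MeasureTheory Filter Set Classical
open scoped ENNReal BigOperators Topology
noncomputable section
attribute [local instance] Classical.propDecidable

/-- Cylinder law of a Markov chain with transition matrix `p` started at `x`. -/
def IsMarkovChainLaw {S : Type*} [MeasurableSpace S]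
    (p : S → S → ℝ≥0∞) (μ : S → Measure (ℕ → S)) : Prop :=
  ∀ x : S, ∀ n : ℕ, ∀ c : ℕ → S,
    μ x {ω | ∀ i ≤ n, ω i = c i}
      = if c 0 = x then ∏ i ∈ Finset.range n, p (c i) (c (i + 1)) else 0

/-- The transition kernel of the cat-and-mouse chain:
`q[(x,y),(z,y)] = p(x,z)` for `x ≠ y`, and `q[(y,y),(z,w)] = p(y,z) p(y,w)`. -/
def catMouseKernel {S : Type*} (p : S → S → ℝ≥0∞) :
    S × S → S × S → ℝ≥0∞ := fun s t =>
  if s.1 ≠ s.2 then (if t.2 = s.2 then p s.1 t.1 else 0)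
  else p s.1 t.1 * p s.1 t.2

open Matrix in
/-- A Doeblin minorization makes a finite stochastic matrix contract vectors of total mass zero. -/
theorem sum_abs_vecMul_le_of_minorization {T : Type*} [Fintype T]
    (A : Matrix T T ℝ) (h1 : ∀ s, ∑ t, A s t = 1)
    (d : T) (ε : ℝ) (h : ∀ s t, 0 ≤ A s t - if t = d then ε else 0)
    (v : T → ℝ) (hv : ∑ s, v s = 0) :
    ∑ t, |(v ᵥ* A) t| ≤ (1 - ε) * ∑ s, |v s| := by
  have key : ∀ t, (v ᵥ* A) t = ∑ s, v s * (A s t - if t = d then ε else 0) := by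
    intro t
    simp only [mul_sub, Finset.sum_sub_distrib, ← Finset.sum_mul, hv, zero_mul, sub_zero]
    rfl
  calc ∑ t, |(v ᵥ* A) t|
      ≤ ∑ t, ∑ s, |v s| * (A s t - if t = d then ε else 0) := by
        refine Finset.sum_le_sum fun t _ => ?_
        rw [key]
        refine (Finset.abs_sum_le_sum_abs _ _).trans (Finset.sum_le_sum fun s _ => ?_)
        rw [abs_mul, abs_of_nonneg (h s t)]
    _ = (1 - ε) * ∑ s, |v s| := by
        rw [Finset.sum_comm]
        simp [← Finset.mul_sum, Finset.sum_sub_distrib, h1, ← Finset.sum_mul, mul_comm]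

open Matrix in
/-- Convergence to equilibrium for a finite stochastic matrix one of whose powers has a
positive column. -/
theorem tendsto_pow_of_pos_column {T : Type*} [Fintype T] [DecidableEq T]
    (Q : Matrix T T ℝ) (hQ : Q ∈ rowStochastic ℝ T)
    (ν : T → ℝ) (hν1 : ∑ t, ν t = 1) (hν : ν ᵥ* Q = ν)
    (m : ℕ) (d : T) (hd : ∀ s, 0 < (Q ^ m) s d) (s t : T) :
    Tendsto (fun n => (Q ^ n) s t) atTop (𝓝 (ν t)) := by
  have hpow : ∀ n, Q ^ n ∈ rowStochastic ℝ T := fun n => pow_mem hQ n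
  have hsum : ∀ n r, ∑ u, (Q ^ n) r u = 1 := fun n => sum_row_of_mem_rowStochastic (hpow n)
  have hnn : ∀ n r u, 0 ≤ (Q ^ n) r u := fun n _ _ => nonneg_of_mem_rowStochastic (hpow n)
  obtain ⟨r₀, hr₀⟩ : ∃ r₀, ∀ r, (Q ^ m) r₀ d ≤ (Q ^ m) r d :=
    have : Nonempty T := ⟨s⟩
    Finite.exists_min fun r => (Q ^ m) r d
  set ε := (Q ^ m) r₀ d with hε
  have hνn : ∀ n, ν ᵥ* Q ^ n = ν := by
    intro n
    induction n with
    | zero => simp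
    | succ n ih => rw [pow_succ, ← vecMul_vecMul, ih, hν]
  set v : ℕ → T → ℝ := fun n u => (Q ^ n) s u - ν u with hvdef
  have hv0 : ∀ n, ∑ u, v n u = 0 := fun n => by
    simp [hvdef, Finset.sum_sub_distrib, hsum, hν1]
  have hvadd : ∀ n k, v (n + k) = v n ᵥ* Q ^ k := by
    intro n k
    have : v n = (Q ^ n).row s - ν := rfl
    rw [this, sub_vecMul, hνn]
    ext u
    simp only [hvdef, pow_add]
    rfl
  set a : ℕ → ℝ := fun n => ∑ u, |v n u| with ha
  have hanti : Antitone a := by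
    refine antitone_nat_of_succ_le fun n => ?_
    have := sum_abs_vecMul_le_of_minorization (Q ^ 1) (hsum 1) d 0
      (fun r u => by simpa using hnn 1 r u) (v n) (hv0 n)
    simpa only [ha, hvadd n 1, sub_zero, one_mul] using this
  have hcontr : ∀ n, a (n + m) ≤ (1 - ε) * a n := fun n => by
    have := sum_abs_vecMul_le_of_minorization (Q ^ m) (hsum m) d ε
      (fun r u => by
        split_ifs with hu
        · subst hu; exact sub_nonneg.2 (hr₀ r)
        · simpa using hnn m r u) (v n) (hv0 n)
    simpa only [ha, hvadd n m] using this
  have ha0 : ∀ n, 0 ≤ a n := fun n => Finset.sum_nonneg fun _ _ => abs_nonneg _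
  have hlim := tendsto_atTop_ciInf hanti ⟨0, by rintro _ ⟨n, rfl⟩; exact ha0 n⟩
  set l := ⨅ n, a n
  have hl0 : 0 ≤ l := ge_of_tendsto' hlim ha0
  have hl1 : l ≤ (1 - ε) * l :=
    le_of_tendsto_of_tendsto' ((tendsto_add_atTop_iff_nat m).2 hlim) (hlim.const_mul _) hcontr
  have hl : l = 0 := by
    have : 0 < ε := hd r₀
    nlinarith
  rw [hl] at hlim
  rw [← tendsto_sub_nhds_zero_iff]
  exact squeeze_zero_norm (fun n => Finset.single_le_sum
    (f := fun u => |v n u|) (fun _ _ => abs_nonneg _) (Finset.mem_univ t)) hlim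

theorem MeasureTheory.measure_eq_sum_inter_fiber {Ω T : Type*} [MeasurableSpace Ω]
    [MeasurableSpace T] [MeasurableSingletonClass T] [Fintype T] (μ : Measure Ω)
    {f : Ω → T} (hf : Measurable f) (A : Set Ω) :
    μ A = ∑ t, μ {ω | f ω = t ∧ ω ∈ A} := by
  have hm : ∀ t, MeasurableSet (f ⁻¹' {t}) := fun t => hf (measurableSet_singleton t)
  have := sum_measure_preimage_singleton (μ := μ.restrict A) (f := f) Finset.univ
    fun t _ => hm t
  simp only [Finset.coe_univ, preimage_univ, Measure.restrict_apply_univ] at this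
  rw [← this]
  exact Finset.sum_congr rfl fun t _ => Measure.restrict_apply (hm t)

section MarkovChainLaw

variable {T : Type*} [MeasurableSpace T] [MeasurableSingletonClass T] [Fintype T]
  [DecidableEq T] {Q : T → T → ℝ≥0∞} {μ : T → Measure (ℕ → T)}

theorem IsMarkovChainLaw.measure_cylinder_and_eval (h : IsMarkovChainLaw Q μ) (s t : T)
    (n m : ℕ) (c : ℕ → T) :
    μ s {ω | (∀ i ≤ m, ω i = c i) ∧ ω (m + n) = t}
      = μ s {ω | ∀ i ≤ m, ω i = c i} * (Matrix.of Q ^ n) (c m) t := by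
  induction n generalizing m c with
  | zero =>
    by_cases hc : c m = t
    · have : {ω : ℕ → T | (∀ i ≤ m, ω i = c i) ∧ ω (m + 0) = t}
          = {ω | ∀ i ≤ m, ω i = c i} := by
        ext ω
        exact ⟨fun hω => hω.1, fun hω => ⟨hω, (hω m le_rfl).trans hc⟩⟩
      rw [this, hc, pow_zero, Matrix.one_apply_eq, mul_one]
    · have : {ω : ℕ → T | (∀ i ≤ m, ω i = c i) ∧ ω (m + 0) = t} = ∅ := by
        ext ω
        exact iff_of_false (fun hω => hc ((hω.1 m le_rfl).symm.trans hω.2)) id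
      rw [this, measure_empty, pow_zero, Matrix.one_apply_ne hc, mul_zero]
  | succ n ih =>
    rw [measure_eq_sum_inter_fiber (μ s) (measurable_pi_apply (m + 1)), pow_succ',
      Matrix.mul_apply, Finset.mul_sum]
    refine Finset.sum_congr rfl fun u _ => ?_
    have hupd : ∀ i ≤ m, Function.update c (m + 1) u i = c i := fun i hi =>
      Function.update_of_ne (by omega) _ _
    have hset : {ω : ℕ → T | ω (m + 1) = u ∧
          ω ∈ {ω : ℕ → T | (∀ i ≤ m, ω i = c i) ∧ ω (m + (n + 1)) = t}}
        = {ω | (∀ i ≤ m + 1, ω i = Function.update c (m + 1) u i) ∧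
            ω (m + 1 + n) = t} := by
      ext ω
      simp only [mem_ofPred_eq, Nat.le_succ_iff_eq_or_le, forall_eq_or_imp,
        Function.update_self, show m + 1 + n = m + (n + 1) by omega, Nat.succ_eq_add_one]
      rw [← and_assoc]
      refine and_congr_left fun _ => and_congr_right fun _ => forall₂_congr fun i hi => ?_
      rw [hupd i hi]
    rw [hset, ih, h, h, Function.update_self, hupd 0 (Nat.zero_le _)]
    split_ifs
    · rw [Finset.prod_range_succ, Function.update_self, hupd m le_rfl,
        Finset.prod_congr rfl fun i hi => by
          rw [hupd i (Finset.mem_range.1 hi).le, hupd (i + 1) (Finset.mem_range.1 hi)],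
        mul_assoc, Matrix.of_apply]
    · simp

theorem IsMarkovChainLaw.measure_eval (h : IsMarkovChainLaw Q μ) (s t : T) (n : ℕ) :
    μ s {ω | ω n = t} = (Matrix.of Q ^ n) s t := by
  rw [measure_eq_sum_inter_fiber (μ s) (measurable_pi_apply 0)]
  have hinit := fun u => h s 0 fun _ => u
  have heval := fun u => h.measure_cylinder_and_eval s t n 0 fun _ => u
  simp only [Nat.le_zero, forall_eq, zero_add, Finset.range_zero, Finset.prod_empty]
    at hinit heval
  simp [heval, hinit]

end MarkovChainLaw

theorem ENNReal.matrix_mul_apply_ne_zero {T : Type*} [Fintype T] {A B : Matrix T T ℝ≥0∞}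
    {s u t : T} (hA : A s u ≠ 0) (hB : B u t ≠ 0) : (A * B) s t ≠ 0 := by
  rw [Matrix.mul_apply]
  exact fun h => mul_ne_zero hA hB (Finset.sum_eq_zero_iff.1 h u (Finset.mem_univ u))

theorem ENNReal.matrix_pow_apply_ne_zero_of_path {T : Type*} [Fintype T] [DecidableEq T]
    {A : Matrix T T ℝ≥0∞} (c : ℕ → T) (n : ℕ) (h : ∀ i < n, A (c i) (c (i + 1)) ≠ 0) :
    (A ^ n) (c 0) (c n) ≠ 0 := by
  induction n with
  | zero => simp
  | succ n ih =>
    rw [pow_succ]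
    exact matrix_mul_apply_ne_zero (ih fun i hi => h i (by omega)) (h n (by omega))

theorem ENNReal.toReal_matrix_pow_apply {T : Type*} [Fintype T] [DecidableEq T]
    {A : Matrix T T ℝ≥0∞} (hA : ∀ s t, A s t ≠ ∞) (n : ℕ) (s t : T) :
    (A ^ n) s t ≠ ∞ ∧ (A.map ENNReal.toReal ^ n) s t = ((A ^ n) s t).toReal := by
  induction n generalizing s with
  | zero => by_cases h : s = t <;> simp [h]
  | succ n ih =>
    have hne : ∀ u, A s u * (A ^ n) u t ≠ ∞ := fun u => ENNReal.mul_ne_top (hA s u) (ih u).1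
    rw [pow_succ', pow_succ', Matrix.mul_apply, Matrix.mul_apply,
      ENNReal.toReal_sum fun u _ => hne u]
    exact ⟨ENNReal.sum_ne_top.2 fun u _ => hne u,
      Finset.sum_congr rfl fun u _ => by rw [ENNReal.toReal_mul, (ih u).2, Matrix.map_apply]⟩

section CatMouse

variable {S : Type*} [Fintype S] {p : S → S → ℝ≥0∞}

theorem sum_catMouseKernel (hp : ∀ x, ∑ y, p x y = 1) (s : S × S) :
    ∑ t, catMouseKernel p s t = 1 := by
  rw [Fintype.sum_prod_type]
  by_cases h : s.1 = s.2
  · simp [catMouseKernel, h, ← Finset.mul_sum, hp]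
  · simp [catMouseKernel, h, hp]

theorem catMouseKernel_pow_diag_ne_zero [DecidableEq S] (n : ℕ) (c : ℕ → S)
    (h : ∀ i < n, p (c i) (c (i + 1)) ≠ 0) :
    (Matrix.of (catMouseKernel p) ^ n) (c 0, c 0) (c n, c n) ≠ 0 :=
  ENNReal.matrix_pow_apply_ne_zero_of_path (fun i => (c i, c i)) n fun i hi => by
    simpa [catMouseKernel] using h i hi

/-- The cat can always catch the mouse. -/
theorem exists_catMouseKernel_pow_ne_zero [DecidableEq S] (n : ℕ) (c : ℕ → S)
    (h : ∀ i < n, p (c i) (c (i + 1)) ≠ 0) :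
    ∃ m, (Matrix.of (catMouseKernel p) ^ m) (c 0, c n) (c n, c n) ≠ 0 := by
  induction n generalizing c with
  | zero => exact ⟨0, by simp⟩
  | succ n ih =>
    by_cases h0 : c 0 = c (n + 1)
    · exact ⟨0, by simp [h0]⟩
    · obtain ⟨m, hm⟩ := ih (fun i => c (i + 1)) fun i hi => h (i + 1) (by omega)
      refine ⟨m + 1, ?_⟩
      rw [pow_succ']
      refine ENNReal.matrix_mul_apply_ne_zero (u := (c 1, c (n + 1))) ?_ hm
      simpa [catMouseKernel, h0] using h 0 (by omega)

theorem exists_catMouseKernel_pow_column_ne_zero [DecidableEq S]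
    (hirr : ∀ x y : S, ∃ n : ℕ, ∃ c : ℕ → S, c 0 = x ∧ c n = y ∧
      ∀ i < n, p (c i) (c (i + 1)) ≠ 0)
    (haper : ∀ x : S, ∃ N₀ : ℕ, ∀ n ≥ N₀, ∃ c : ℕ → S, c 0 = x ∧ c n = x ∧
      ∀ i < n, p (c i) (c (i + 1)) ≠ 0) (a : S) :
    ∃ m, ∀ s, (Matrix.of (catMouseKernel p) ^ m) s (a, a) ≠ 0 := by
  have hs : ∀ s : S × S, ∃ k, ∀ m ≥ k,
      (Matrix.of (catMouseKernel p) ^ m) s (a, a) ≠ 0 := by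
    rintro ⟨x, y⟩
    obtain ⟨n₁, c₁, rfl, rfl, h₁⟩ := hirr x y
    obtain ⟨m₁, hm₁⟩ := exists_catMouseKernel_pow_ne_zero n₁ c₁ h₁
    obtain ⟨n₂, c₂, h₂0, rfl, h₂⟩ := hirr (c₁ n₁) a
    have hm₂ := catMouseKernel_pow_diag_ne_zero n₂ c₂ h₂
    rw [h₂0] at hm₂
    obtain ⟨N₀, hN₀⟩ := haper (c₂ n₂)
    refine ⟨m₁ + n₂ + N₀, fun m hm => ?_⟩
    obtain ⟨c₃, h₃0, h₃n, h₃⟩ := hN₀ (m - (m₁ + n₂)) (by omega)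
    have hm₃ := catMouseKernel_pow_diag_ne_zero _ c₃ h₃
    rw [h₃0, h₃n] at hm₃
    rw [show m = m₁ + n₂ + (m - (m₁ + n₂)) by omega, pow_add, pow_add]
    exact ENNReal.matrix_mul_apply_ne_zero (ENNReal.matrix_mul_apply_ne_zero hm₁ hm₂) hm₃
  choose k hk using hs
  exact ⟨Finset.univ.sup k, fun s => hk s _ (Finset.le_sup (Finset.mem_univ s))⟩

/-- For a reversible chain without loops, `(x, y) ↦ π x * (1 - p x y)` is invariant for the
cat-and-mouse chain. -/
theorem vecMul_catMouseKernel_of_reversible (hnoloop : ∀ x, p x x = 0) {π : S → ℝ}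
    (hinv : ∀ y, ∑ x, π x * (p x y).toReal = π y)
    (hrev : ∀ x y, π x * (p x y).toReal = π y * (p y x).toReal) :
    Matrix.vecMul (fun s : S × S => π s.1 * (1 - (p s.1 s.2).toReal))
        ((Matrix.of (catMouseKernel p)).map ENNReal.toReal)
      = fun s => π s.1 * (1 - (p s.1 s.2).toReal) := by
  ext ⟨z, w⟩
  simp only [Matrix.vecMul, dotProduct, Matrix.map_apply, Matrix.of_apply]
  have hterm : ∀ x y : S, π x * (1 - (p x y).toReal) * (catMouseKernel p (x, y) (z, w)).toReal
      = (if y = w then π x * (1 - (p x y).toReal) * (p x z).toReal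
          - (if y = x then π x * (p x z).toReal else 0) else 0)
        + if y = x then π x * ((p x z).toReal * (p x w).toReal) else 0 := by
    intro x y
    by_cases hxy : x = y
    · subst hxy
      by_cases hxw : x = w <;> simp [catMouseKernel, hnoloop, hxw]
    · by_cases hyw : y = w
      · subst hyw; simp [catMouseKernel, hxy, Ne.symm hxy]
      · simp [catMouseKernel, hxy, Ne.symm hxy, hyw, Ne.symm hyw]
  rw [Fintype.sum_prod_type]
  simp only [hterm, Finset.sum_add_distrib, Finset.sum_ite_eq', Finset.mem_univ, if_true,
    Finset.sum_sub_distrib, Finset.sum_ite_eq]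
  have hsum : ∑ x, π x * (1 - (p x w).toReal) * (p x z).toReal
      + ∑ x, π x * ((p x z).toReal * (p x w).toReal) = π z := by
    rw [← hinv z, ← Finset.sum_add_distrib]
    exact Finset.sum_congr rfl fun x _ => by ring
  linarith [hrev w z]

end CatMouse

/-- For a finite, irreducible, aperiodic, reversible chain without loops on `N` states,
the mouse location in the cat-and-mouse chain converges in distribution to
`ℙ(M_∞ = y) = (1 - π(y)) / (N - 1)`. -/
theorem mouse_limit_distribution_reversible_finite
    {S : Type*} [MeasurableSpace S] [MeasurableSingletonClass S] [Fintype S]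
    (N : ℕ) (hN : Fintype.card S = N)
    (p : S → S → ℝ≥0∞) (π : S → ℝ≥0∞)
    (hstoch : ∀ x, ∑' y, p x y = 1)
    (hnoloop : ∀ x, p x x = 0)
    -- irreducibility
    (hirr : ∀ x y : S, ∃ n : ℕ, ∃ c : ℕ → S, c 0 = x ∧ c n = y ∧
      ∀ i < n, p (c i) (c (i + 1)) ≠ 0)
    -- aperiodicity
    (haper : ∀ x : S, ∃ N₀ : ℕ, ∀ n ≥ N₀, ∃ c : ℕ → S, c 0 = x ∧ c n = x ∧
      ∀ i < n, p (c i) (c (i + 1)) ≠ 0)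
    -- `π` is an invariant probability distribution, everywhere positive
    (hπpos : ∀ x, 0 < π x) (hπprob : ∑' x, π x = 1)
    (hinv : ∀ y, ∑' x, π x * p x y = π y)
    -- reversibility
    (hrev : ∀ x y, π x * p x y = π y * p y x)
    -- `μcm (x,y)` is the law of the cat-and-mouse chain started at `(x,y)`
    (μcm : S × S → Measure (ℕ → S × S))
    (hμcm : IsMarkovChainLaw (catMouseKernel p) μcm) :
    ∀ x₀ y₀ y : S,
      Tendsto (fun n => μcm (x₀, y₀) {ω | (ω n).2 = y}) atTop
        (nhds ((1 - π y) / (N - 1 : ℕ))) := by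
  intro x₀ y₀ y
  simp only [tsum_fintype] at hstoch hπprob hinv
  have hp : ∀ x y, p x y ≠ ∞ := fun x y =>
    ((Finset.single_le_sum (fun _ _ => zero_le) (Finset.mem_univ y)).trans
      (hstoch x).le).trans_lt ENNReal.one_lt_top |>.ne
  have hπ : ∀ x, π x ≠ ∞ := fun x =>
    ((Finset.single_le_sum (fun _ _ => zero_le) (Finset.mem_univ x)).trans
      hπprob.le).trans_lt ENNReal.one_lt_top |>.ne
  have hprob : ∑ x, (π x).toReal = 1 := by
    rw [← ENNReal.toReal_sum fun x _ => hπ x, hπprob, ENNReal.toReal_one]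
  have hinvR : ∀ y, ∑ x, (π x).toReal * (p x y).toReal = (π y).toReal := fun y => by
    rw [← hinv y, ENNReal.toReal_sum fun x _ => ENNReal.mul_ne_top (hπ x) (hp x y)]
    simp only [ENNReal.toReal_mul]
  have hrevR : ∀ x y, (π x).toReal * (p x y).toReal = (π y).toReal * (p y x).toReal :=
    fun x y => by simpa only [ENNReal.toReal_mul] using congrArg ENNReal.toReal (hrev x y)
  have hcard : 2 ≤ N := by
    by_contra! hlt
    have : Subsingleton S := Fintype.card_le_one_iff_subsingleton.1 (by omega)
    have h0 : ∑ z, p y z = 0 :=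
      Finset.sum_eq_zero fun z _ => Subsingleton.elim y z ▸ hnoloop y
    exact zero_ne_one (h0.symm.trans (hstoch y))
  have hN1 : (0 : ℝ) < (N - 1 : ℕ) := by exact_mod_cast (by omega : 0 < N - 1)
  set K := (Matrix.of (catMouseKernel p)).map ENNReal.toReal with hK
  have hK1 := sum_catMouseKernel hstoch
  have hKtop : ∀ s t, Matrix.of (catMouseKernel p) s t ≠ ∞ := fun s t =>
    ((Finset.single_le_sum (f := catMouseKernel p s) (fun _ _ => zero_le)
      (Finset.mem_univ t)).trans (hK1 s).le).trans_lt ENNReal.one_lt_top |>.ne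
  have hKstoch : K ∈ Matrix.rowStochastic ℝ (S × S) := by
    refine Matrix.mem_rowStochastic_iff_sum.2 ⟨fun _ _ => ENNReal.toReal_nonneg, fun s => ?_⟩
    simp only [hK, Matrix.map_apply]
    rw [← ENNReal.toReal_sum fun t _ => hKtop s t]
    simp [hK1]
  have hpow := ENNReal.toReal_matrix_pow_apply hKtop
  obtain ⟨m, hm⟩ := exists_catMouseKernel_pow_column_ne_zero hirr haper y
  have hmarg : ∀ w, ∑ z, (π z).toReal * (1 - (p z w).toReal) = 1 - (π w).toReal := fun w => by
    simp only [mul_sub, mul_one, Finset.sum_sub_distrib, hprob, hinvR]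
  set ν : S × S → ℝ := fun s => (π s.1).toReal * (1 - (p s.1 s.2).toReal) with hνdef
  set r : ℝ := ((N - 1 : ℕ) : ℝ)⁻¹ with hr
  have hmass : ∑ s, (r • ν) s = 1 := by
    simp only [Pi.smul_apply, smul_eq_mul, ← Finset.mul_sum]
    rw [Fintype.sum_prod_type_right]
    simp only [hνdef, hmarg, Finset.sum_sub_distrib, hprob]
    rw [Finset.sum_const, Finset.card_univ, hN, hr, nsmul_one,
      Nat.cast_sub (by omega : 1 ≤ N), Nat.cast_one]
    rw [Nat.cast_sub (by omega : 1 ≤ N), Nat.cast_one] at hN1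
    exact inv_mul_cancel₀ hN1.ne'
  have hνinv : Matrix.vecMul (r • ν) K = r • ν := by
    rw [Matrix.smul_vecMul, hK, vecMul_catMouseKernel_of_reversible hnoloop hinvR hrevR]
  have hconv := tendsto_pow_of_pos_column K hKstoch (r • ν) hmass hνinv m (y, y)
    (fun s => by
      rw [hK, (hpow m s (y, y)).2]
      exact ENNReal.toReal_pos (hm s) (hpow m s (y, y)).1) (x₀, y₀)
  have hlim : Tendsto (fun n => ∑ z, (K ^ n) (x₀, y₀) (z, y)) atTop
      (𝓝 ((1 - (π y).toReal) / (N - 1 : ℕ))) := by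
    have hval : ∑ z, (r • ν) (z, y) = (1 - (π y).toReal) / (N - 1 : ℕ) := by
      simp only [Pi.smul_apply, smul_eq_mul, ← Finset.mul_sum, hνdef, hmarg]
      rw [hr, mul_comm, div_eq_mul_inv]
    rw [← hval]
    exact tendsto_finsetSum _ fun z _ => hconv (z, y)
  have hmeas : ∀ n, μcm (x₀, y₀) {ω | (ω n).2 = y}
      = ENNReal.ofReal (∑ z, (K ^ n) (x₀, y₀) (z, y)) := fun n => by
    rw [measure_eq_sum_inter_fiber (μcm (x₀, y₀)) (measurable_pi_apply n),
      Fintype.sum_prod_type, ENNReal.ofReal_sum_of_nonneg fun z _ => by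
        rw [hK, (hpow n _ _).2]; exact ENNReal.toReal_nonneg]
    refine Finset.sum_congr rfl fun z _ => ?_
    rw [hK, (hpow n _ _).2, ENNReal.ofReal_toReal (hpow n _ _).1, ← hμcm.measure_eval]
    rw [Finset.sum_eq_single y]
    · congr 1
      ext ω
      exact ⟨fun h => h.1, fun h => ⟨h, by simp [show ω n = (z, y) from h]⟩⟩
    · intro w _ hw
      have : {ω : ℕ → S × S | ω n = (z, w) ∧ ω ∈ {ω : ℕ → S × S | (ω n).2 = y}} = ∅ := by
        ext ω
        exact iff_of_false (fun h => hw (by simpa [h.1] using h.2)) id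
      rw [this, measure_empty]
    · simp
  have hgoal : (1 - π y) / ((N - 1 : ℕ) : ℝ≥0∞)
      = ENNReal.ofReal ((1 - (π y).toReal) / (N - 1 : ℕ)) := by
    rw [ENNReal.ofReal_div_of_pos hN1, ENNReal.ofReal_natCast,
      ENNReal.ofReal_sub _ ENNReal.toReal_nonneg, ENNReal.ofReal_one,
      ENNReal.ofReal_toReal (hπ y)]
  rw [hgoal]
  simp only [hmeas]
  exact ENNReal.tendsto_ofReal hlim
end
end

section
/- Let $(C'_n,M'_n)$ be the cat-and-mouse chain on $\mathbb{Z}$ associated with the simple random walk with up-probability $p\in(0,1/2)$ and down-probability $1-p$, started at $(0,0)$, and let $M'_\infty=\lim_n M'_n$ denote the final location of the mouse (the mouse moves only finitely many times a.s.). Then for $u$ on the unit circle, $\mathbb{E}(u^{M'_\infty})=\dfrac{\rho(1-\rho)u^2}{-\rho^2u^2+(1+\rho)u-1}$, where $\rho=p/(1-p)$. -/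
open MeasureTheory Filter Set Classical
open scoped ENNReal BigOperators Topology
noncomputable section
attribute [local instance] Classical.propDecidable

/-- Transition matrix of the simple random walk on `ℤ` with up-probability `p`. -/
def freeP (p : ℝ) : ℤ → ℤ → ℝ≥0∞ := fun x y =>
  if y = x + 1 then ENNReal.ofReal p
  else if y = x - 1 then ENNReal.ofReal (1 - p)
  else 0

/-- The final (limiting) location of the mouse along a path. -/
def mouseLimit (ω : ℕ → ℤ × ℤ) : ℤ := limUnder Filter.atTop (fun n => (ω n).2)


/-- Prepend a state to a path. -/
def consPath {S : Type*} (s : S) (ω : ℕ → S) : ℕ → S := fun n => Nat.casesOn n s ω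

@[simp] lemma consPath_zero {S : Type*} (s : S) (ω : ℕ → S) : consPath s ω 0 = s := rfl

@[simp] lemma consPath_succ {S : Type*} (s : S) (ω : ℕ → S) (n : ℕ) : consPath s ω (n + 1) = ω n := rfl

lemma measurable_consPath {S : Type*} [MeasurableSpace S] (s : S) : Measurable (consPath s) := by
  refine measurable_pi_iff.2 fun n => ?_
  cases n with
  | zero => exact measurable_const
  | succ n => exact measurable_pi_apply n

lemma measurableSet_cylinder {S : Type*} [MeasurableSpace S] [MeasurableSingletonClass S]
    (n : ℕ) (c : ℕ → S) :
    MeasurableSet {ω : ℕ → S | ∀ i ≤ n, ω i = c i} := by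
  have : {ω : ℕ → S | ∀ i ≤ n, ω i = c i} = ⋂ i, ⋂ _ : i ≤ n, (fun ω => ω i) ⁻¹' {c i} := by
    ext; simp
  rw [this]
  exact .iInter fun i => .iInter fun _ => measurable_pi_apply i (measurableSet_singleton _)

lemma isPiSystem_cylinders {S : Type*} :
    IsPiSystem {A : Set (ℕ → S) | ∃ (n : ℕ) (c : ℕ → S), A = {ω | ∀ i ≤ n + 1, ω i = c i}} := by
  rintro _ ⟨n, c, rfl⟩ _ ⟨m, d, rfl⟩ ⟨η, hη, hη'⟩
  refine ⟨max n m, η, ?_⟩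
  ext ω
  simp only [mem_inter_iff, mem_ofPred_eq] at *
  constructor
  · rintro ⟨h, h'⟩ i hi
    rcases le_total n m with hnm | hnm
    · rw [h' i (by omega), hη' i (by omega)]
    · rw [h i (by omega), hη i (by omega)]
  · intro h
    exact ⟨fun i hi => by rw [h i (by omega), hη i hi],
      fun i hi => by rw [h i (by omega), hη' i hi]⟩

lemma generateFrom_cylinders {S : Type*} [MeasurableSpace S] [Countable S] [MeasurableSingletonClass S] :
    (MeasurableSpace.pi : MeasurableSpace (ℕ → S)) = MeasurableSpace.generateFrom
      {A | ∃ (n : ℕ) (c : ℕ → S), A = {ω | ∀ i ≤ n + 1, ω i = c i}} := by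
  apply le_antisymm
  · refine iSup_le fun n => ?_
    rw [← measurable_iff_comap_le]
    refine @measurable_to_countable' _ _ _ _ (MeasurableSpace.generateFrom _) _ fun x => ?_
    have : (fun ω : ℕ → S => ω n) ⁻¹' {x} =
        ⋃ c : {c : Fin (n + 2) → S // c ⟨n, by omega⟩ = x},
          {ω | ∀ i ≤ n + 1, ω i = (fun j => if h : j < n + 2 then c.1 ⟨j, h⟩ else x) i} := by
      ext ω
      simp only [mem_preimage, mem_singleton_iff, mem_iUnion, mem_ofPred_eq]
      constructor
      · intro h
        refine ⟨⟨fun i => ω i, h⟩, fun i hi => ?_⟩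
        rw [dif_pos (by omega)]
      · rintro ⟨c, hc⟩
        rw [hc n (by omega), dif_pos (by omega), c.2]
    rw [this]
    exact @MeasurableSet.iUnion _ _ (MeasurableSpace.generateFrom _) _ _ fun c =>
      MeasurableSpace.measurableSet_generateFrom ⟨n, _, rfl⟩
  · refine MeasurableSpace.generateFrom_le ?_
    rintro _ ⟨n, c, rfl⟩
    exact measurableSet_cylinder _ _

/-- Cylinders of length at least two determine a finite measure on path space. -/
lemma ext_of_cylinders {S : Type*} [MeasurableSpace S] [Countable S] [MeasurableSingletonClass S]
    {μ ν : Measure (ℕ → S)} [IsFiniteMeasure μ]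
    (h : ∀ (n : ℕ) (c : ℕ → S), μ {ω | ∀ i ≤ n + 1, ω i = c i} = ν {ω | ∀ i ≤ n + 1, ω i = c i}) :
    μ = ν := by
  refine Measure.ext_of_generateFrom_of_cover_subset
    (T := range fun a : S × S => {ω : ℕ → S | ∀ i ≤ 0 + 1, ω i = if i = 0 then a.1 else a.2})
    generateFrom_cylinders isPiSystem_cylinders ?_ (countable_range _) ?_
    (fun _ _ => measure_ne_top _ _) ?_
  · rintro _ ⟨a, rfl⟩
    exact ⟨0, _, rfl⟩
  · refine eq_univ_of_forall fun ω => ⟨_, ⟨(ω 0, ω 1), rfl⟩, fun i hi => ?_⟩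
    obtain rfl | rfl : i = 0 ∨ i = 1 := by omega
    · rfl
    · rfl
  · rintro _ ⟨n, c, rfl⟩
    exact h n c

/-- The Markov property at time one. -/
lemma IsMarkovChainLaw.eq_sum_map_consPath {S : Type*} [MeasurableSpace S] [Countable S] [MeasurableSingletonClass S]
    {q : S → S → ℝ≥0∞} {μ : S → Measure (ℕ → S)} [∀ s, IsProbabilityMeasure (μ s)]
    (hμ : IsMarkovChainLaw q μ) (s : S) (T : Finset S) (hT : ∀ t ∉ T, q s t = 0) :
    μ s = ∑ t ∈ T, q s t • (μ t).map (consPath s) := by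
  refine ext_of_cylinders fun n c => ?_
  have key : ∀ t, (μ t).map (consPath s) {ω | ∀ i ≤ n + 1, ω i = c i} =
      if c 0 = s ∧ c 1 = t then ∏ i ∈ Finset.range n, q (c (i + 1)) (c (i + 2)) else 0 := by
    intro t
    rw [Measure.map_apply (measurable_consPath s) (measurableSet_cylinder _ _)]
    by_cases hc : c 0 = s
    · have : consPath s ⁻¹' {ω | ∀ i ≤ n + 1, ω i = c i} =
          {ω | ∀ i ≤ n, ω i = (fun j => c (j + 1)) i} := by
        ext ω
        simp only [mem_preimage, mem_ofPred_eq]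
        constructor
        · intro h i hi
          exact h (i + 1) (by omega)
        · intro h i hi
          cases i with
          | zero => exact hc.symm
          | succ i => exact h i (by omega)
      rw [this, hμ t n]
      simp [hc]
    · have : consPath s ⁻¹' {ω | ∀ i ≤ n + 1, ω i = c i} = ∅ := by
        ext ω
        simp only [mem_preimage, mem_ofPred_eq, mem_empty_iff_false, iff_false]
        exact fun h => hc (h 0 (by omega)).symm
      simp [this, hc]
  rw [hμ s (n + 1) c]
  simp only [Measure.coe_finsetSum, Finset.sum_apply, Measure.smul_apply, key, smul_eq_mul]
  by_cases hc : c 0 = s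
  · simp only [hc, true_and, if_true, mul_ite, mul_zero, Finset.sum_ite_eq]
    rw [Finset.prod_range_succ', mul_comm, zero_add, hc]
    split_ifs with h
    · rfl
    · rw [hT _ h, zero_mul]
  · simp [hc]

lemma IsMarkovChainLaw.integral_eq_sum {S : Type*} [MeasurableSpace S] [Countable S] [MeasurableSingletonClass S]
    {q : S → S → ℝ≥0∞} {μ : S → Measure (ℕ → S)} {E : Type*} [NormedAddCommGroup E] [NormedSpace ℝ E]
    [∀ s, IsProbabilityMeasure (μ s)]
    (hμ : IsMarkovChainLaw q μ) (s : S) (T : Finset S) (hT : ∀ t ∉ T, q s t = 0)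
    {f : (ℕ → S) → E} (hf : StronglyMeasurable f) {C : ℝ} (hC : ∀ ω, ‖f ω‖ ≤ C) :
    ∫ ω, f ω ∂μ s = ∑ t ∈ T, (q s t).toReal • ∫ ω, f (consPath s ω) ∂μ t := by
  have hfin : ∀ t ∈ T, IsFiniteMeasure (q s t • (μ t).map (consPath s)) := by
    intro t ht
    refine isFiniteMeasure_of_le (μ s) ?_
    rw [hμ.eq_sum_map_consPath s T hT]
    exact Finset.single_le_sum (f := fun t => q s t • (μ t).map (consPath s))
      (fun _ _ => Measure.zero_le _) ht
  conv_lhs => rw [hμ.eq_sum_map_consPath s T hT]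
  rw [integral_finsetSum_measure]
  · refine Finset.sum_congr rfl fun t _ => ?_
    rw [integral_smul_measure,
      integral_map (measurable_consPath s).aemeasurable hf.aestronglyMeasurable]
  · intro t ht
    have := hfin t ht
    exact .of_bound hf.aestronglyMeasurable C (.of_forall hC)

/-- Translate both coordinates of a path by `k`. -/
def shiftPath (k : ℤ) (ω : ℕ → ℤ × ℤ) : ℕ → ℤ × ℤ := fun n => ((ω n).1 + k, (ω n).2 + k)

lemma measurable_shiftPath (k : ℤ) : Measurable (shiftPath k) :=
  measurable_pi_iff.2 fun n =>
    (measurable_of_countable fun x : ℤ × ℤ => (x.1 + k, x.2 + k)).comp (measurable_pi_apply n)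

lemma freeP_add_right (p : ℝ) (x y k : ℤ) : freeP p (x + k) (y + k) = freeP p x y := by
  simp only [freeP, show y + k = x + k + 1 ↔ y = x + 1 by omega,
    show y + k = x + k - 1 ↔ y = x - 1 by omega]

lemma catMouseKernel_freeP_add_right (p : ℝ) (s t : ℤ × ℤ) (k : ℤ) :
    catMouseKernel (freeP p) (s.1 + k, s.2 + k) (t.1 + k, t.2 + k) =
      catMouseKernel (freeP p) s t := by
  by_cases h : s.1 = s.2 <;> simp [catMouseKernel, freeP_add_right, h]

lemma catMouse_map_shiftPath {p : ℝ} {μ : ℤ × ℤ → Measure (ℕ → ℤ × ℤ)}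
    [∀ s, IsProbabilityMeasure (μ s)] (hμ : IsMarkovChainLaw (catMouseKernel (freeP p)) μ)
    (s : ℤ × ℤ) (k : ℤ) : μ (s.1 + k, s.2 + k) = (μ s).map (shiftPath k) := by
  refine ext_of_cylinders fun n c => ?_
  have hpre : shiftPath k ⁻¹' {ω | ∀ i ≤ n + 1, ω i = c i} =
      {ω | ∀ i ≤ n + 1, ω i = shiftPath (-k) c i} := by
    ext ω
    simp only [mem_preimage, mem_ofPred_eq, shiftPath, Prod.ext_iff]
    refine forall₂_congr fun i _ => ?_
    constructor <;> rintro ⟨h, h'⟩ <;> constructor <;> simp at * <;> omega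
  rw [Measure.map_apply (measurable_shiftPath k) (measurableSet_cylinder _ _), hpre,
    hμ _ (n + 1) c, hμ s (n + 1)]
  have h0 : c 0 = (s.1 + k, s.2 + k) ↔ shiftPath (-k) c 0 = s := by
    simp only [shiftPath, Prod.ext_iff]
    constructor <;> rintro ⟨h, h'⟩ <;> constructor <;> omega
  simp only [h0]
  split_ifs
  · refine Finset.prod_congr rfl fun i _ => ?_
    exact (catMouseKernel_freeP_add_right p (c i) (c (i + 1)) (-k)).symm
  · rfl

lemma catMouse_integral_of_ne {p : ℝ} (hp : 0 ≤ p) (hp1 : p ≤ 1)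
    {μ : ℤ × ℤ → Measure (ℕ → ℤ × ℤ)} [∀ s, IsProbabilityMeasure (μ s)]
    (hμ : IsMarkovChainLaw (catMouseKernel (freeP p)) μ)
    {E : Type*} [NormedAddCommGroup E] [NormedSpace ℝ E]
    {f : (ℕ → ℤ × ℤ) → E} (hf : StronglyMeasurable f) {C : ℝ} (hC : ∀ ω, ‖f ω‖ ≤ C)
    {x y : ℤ} (hxy : x ≠ y) :
    ∫ ω, f ω ∂μ (x, y) = p • ∫ ω, f (consPath (x, y) ω) ∂μ (x + 1, y) +
      (1 - p) • ∫ ω, f (consPath (x, y) ω) ∂μ (x - 1, y) := by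
  rw [hμ.integral_eq_sum (x, y) {(x + 1, y), (x - 1, y)} _ hf hC, Finset.sum_pair]
  · congr 2
    · simp [catMouseKernel, freeP, hxy, hp]
    · have : x - 1 ≠ x + 1 := by omega
      simp [catMouseKernel, freeP, hxy, hp1, this]
  · simp; omega
  · rintro ⟨a, b⟩ hab
    simp only [Finset.mem_insert, Finset.mem_singleton, Prod.mk.injEq, not_or, not_and] at hab
    simp only [catMouseKernel, freeP]
    split_ifs <;> simp_all

lemma catMouse_integral_diag {p : ℝ} (hp : 0 ≤ p) (hp1 : p ≤ 1)
    {μ : ℤ × ℤ → Measure (ℕ → ℤ × ℤ)} [∀ s, IsProbabilityMeasure (μ s)]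
    (hμ : IsMarkovChainLaw (catMouseKernel (freeP p)) μ)
    {E : Type*} [NormedAddCommGroup E] [NormedSpace ℝ E]
    {f : (ℕ → ℤ × ℤ) → E} (hf : StronglyMeasurable f) {C : ℝ} (hC : ∀ ω, ‖f ω‖ ≤ C) :
    ∫ ω, f ω ∂μ (0, 0) =
      (p * p) • ∫ ω, f (consPath (0, 0) ω) ∂μ (1, 1) +
      ((p * (1 - p)) • ∫ ω, f (consPath (0, 0) ω) ∂μ (1, -1) +
      (((1 - p) * p) • ∫ ω, f (consPath (0, 0) ω) ∂μ (-1, 1) +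
      ((1 - p) * (1 - p)) • ∫ ω, f (consPath (0, 0) ω) ∂μ (-1, -1))) := by
  rw [hμ.integral_eq_sum (0, 0) {(1, 1), (1, -1), (-1, 1), (-1, -1)} _ hf hC,
    Finset.sum_insert (by decide), Finset.sum_insert (by decide), Finset.sum_pair (by decide)]
  · simp [catMouseKernel, freeP, hp, hp1]
  · rintro ⟨a, b⟩ hab
    simp only [Finset.mem_insert, Finset.mem_singleton, Prod.mk.injEq, not_or, not_and] at hab
    simp only [catMouseKernel, freeP]
    split_ifs <;> simp_all

/-- From distance `k` below the mouse, the mouse ever moves with probability at most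
`(p / (1 - p)) ^ k`: bound up to time `n`. -/
lemma catMouse_measureReal_moved_le {p : ℝ} (hp : 0 < p) (hp2 : p < 1 / 2)
    {μ : ℤ × ℤ → Measure (ℕ → ℤ × ℤ)} [∀ s, IsProbabilityMeasure (μ s)]
    (hμ : IsMarkovChainLaw (catMouseKernel (freeP p)) μ) (n k : ℕ) :
    (μ (-k, 0)).real {ω | ∃ i ≤ n, (ω i).2 ≠ 0} ≤ (p / (1 - p)) ^ k := by
  have hmeas : ∀ n, MeasurableSet {ω : ℕ → ℤ × ℤ | ∃ i ≤ n, (ω i).2 ≠ 0} := by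
    intro n
    have : {ω : ℕ → ℤ × ℤ | ∃ i ≤ n, (ω i).2 ≠ 0} =
        ⋃ i, ⋃ _ : i ≤ n, (fun ω => ω i) ⁻¹' {s | s.2 ≠ 0} := by
      ext; simp
    rw [this]
    exact .iUnion fun i => .iUnion fun _ => measurable_pi_apply i (Set.to_countable _).measurableSet
  have hq : 0 < 1 - p := by linarith
  induction n generalizing k with
  | zero =>
    have h1 : μ (-k, 0) {ω | ∀ i ≤ 0, ω i = (fun _ => ((-k : ℤ), (0 : ℤ))) i} = 1 := by
      rw [hμ]; simp
    have h2 : μ (-k, 0) {ω | ∃ i ≤ 0, (ω i).2 ≠ 0} = 0 := by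
      rw [← prob_compl_eq_one_iff (hmeas 0)]
      refine le_antisymm prob_le_one (h1.symm.trans_le (measure_mono ?_))
      intro ω hω
      simp at hω ⊢
      simp [hω]
    rw [Measure.real, h2]
    simp only [ENNReal.toReal_zero]
    positivity
  | succ n ih =>
    obtain _ | k := k
    · simp
    have hstep : (consPath (-((k + 1 : ℕ) : ℤ), (0 : ℤ))) ⁻¹' {ω | ∃ i ≤ n + 1, (ω i).2 ≠ 0}
        = {ω | ∃ i ≤ n, (ω i).2 ≠ 0} := by
      ext ω
      simp only [mem_preimage, mem_ofPred_eq]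
      constructor
      · rintro ⟨_ | i, hi, h⟩
        · simp at h
        · exact ⟨i, by omega, h⟩
      · rintro ⟨i, hi, h⟩
        exact ⟨i + 1, by omega, h⟩
    have hint := catMouse_integral_of_ne hp.le (by linarith) hμ
      (f := Set.indicator {ω | ∃ i ≤ n + 1, (ω i).2 ≠ 0} (1 : (ℕ → ℤ × ℤ) → ℝ)) (C := 1)
      (stronglyMeasurable_one.indicator (hmeas _))
      (fun ω => by by_cases h : ω ∈ {ω : ℕ → ℤ × ℤ | ∃ i ≤ n + 1, (ω i).2 ≠ 0} <;> simp [h])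
      (x := -((k + 1 : ℕ) : ℤ)) (y := 0) (by omega)
    have hcomp : (fun ω => Set.indicator {ω | ∃ i ≤ n + 1, (ω i).2 ≠ 0}
        (1 : (ℕ → ℤ × ℤ) → ℝ) (consPath (-((k + 1 : ℕ) : ℤ), (0 : ℤ)) ω)) =
        Set.indicator {ω | ∃ i ≤ n, (ω i).2 ≠ 0} 1 := by
      rw [← hstep]; rfl
    rw [hcomp, integral_indicator_one (hmeas _), integral_indicator_one (hmeas _),
      integral_indicator_one (hmeas _)] at hint
    rw [hint, show -((k + 1 : ℕ) : ℤ) + 1 = -(k : ℤ) by push_cast; ring,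
      show -((k + 1 : ℕ) : ℤ) - 1 = -((k + 2 : ℕ) : ℤ) by push_cast; ring]
    calc p • (μ (-k, 0)).real _ + (1 - p) • (μ (-((k + 2 : ℕ) : ℤ), 0)).real _
        ≤ p • (p / (1 - p)) ^ k + (1 - p) • (p / (1 - p)) ^ (k + 2) := by
          gcongr
          · exact ih k
          · exact ih (k + 2)
      _ = (p / (1 - p)) ^ (k + 1) := by
          simp only [smul_eq_mul]
          have hr : p / (1 - p) * (1 - p) = p := div_mul_cancel₀ _ hq.ne'
          linear_combination (p / (1 - p)) ^ k * (p / (1 - p) - 1) * hr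

lemma catMouse_measureReal_ever_moved_le {p : ℝ} (hp : 0 < p) (hp2 : p < 1 / 2)
    {μ : ℤ × ℤ → Measure (ℕ → ℤ × ℤ)} [∀ s, IsProbabilityMeasure (μ s)]
    (hμ : IsMarkovChainLaw (catMouseKernel (freeP p)) μ) (k : ℕ) :
    (μ (-k, 0)).real {ω | ∃ i, (ω i).2 ≠ 0} ≤ (p / (1 - p)) ^ k := by
  have hU : {ω : ℕ → ℤ × ℤ | ∃ i, (ω i).2 ≠ 0} = ⋃ n, {ω | ∃ i ≤ n, (ω i).2 ≠ 0} := by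
    ext ω
    simp only [mem_ofPred_eq, mem_iUnion]
    exact ⟨fun ⟨i, hi⟩ => ⟨i, i, le_rfl, hi⟩, fun ⟨_, i, _, hi⟩ => ⟨i, hi⟩⟩
  have hmono : Monotone fun n => {ω : ℕ → ℤ × ℤ | ∃ i ≤ n, (ω i).2 ≠ 0} :=
    fun a b hab ω ⟨i, hi, h⟩ => ⟨i, hi.trans hab, h⟩
  rw [hU]
  refine le_of_tendsto' ((ENNReal.tendsto_toReal (measure_ne_top _ _)).comp
    (tendsto_measure_iUnion_atTop hmono)) fun n => ?_
  exact catMouse_measureReal_moved_le hp hp2 hμ n k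

/-- A bounded sequence satisfying the walk's harmonic recurrence on `n ≥ 1`, with stronger
weight on the smaller index, is constant at the start. -/
lemma eq_of_bounded_recurrence {p : ℝ} (hp : 0 < p) (hp2 : p < 1 / 2) {a : ℕ → ℂ} {C : ℝ}
    (hC : ∀ n, ‖a n‖ ≤ C) (ha : ∀ n, a (n + 1) = p * a (n + 2) + (1 - p) * a n) :
    a 2 = a 0 := by
  have hpc : (p : ℂ) ≠ 0 := by exact_mod_cast hp.ne'
  have hd : ∀ n, a (n + 1) - a n = ((1 - p) / p : ℂ) ^ n * (a 1 - a 0) := by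
    intro n
    induction n with
    | zero => simp
    | succ n ih =>
      rw [pow_succ', mul_assoc, ← ih]
      field_simp
      linear_combination -ha n
  have hr : 1 < (1 - p) / p := by rw [lt_div_iff₀ hp]; linarith
  have h0 : a 1 - a 0 = 0 := by
    by_contra h
    have hpos : 0 < ‖a 1 - a 0‖ := norm_pos_iff.2 h
    obtain ⟨n, hn⟩ := pow_unbounded_of_one_lt (2 * C / ‖a 1 - a 0‖) hr
    rw [div_lt_iff₀ hpos] at hn
    have h1 : ‖a (n + 1) - a n‖ ≤ 2 * C :=
      (norm_sub_le _ _).trans (by linarith [hC (n + 1), hC n])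
    have h2 : ‖((1 - p) / p : ℂ)‖ = (1 - p) / p := by
      rw [show ((1 - p) / p : ℂ) = (((1 - p) / p : ℝ) : ℂ) by push_cast; rfl,
        Complex.norm_real, Real.norm_of_nonneg (by linarith)]
    rw [hd, norm_mul, norm_pow, h2] at h1
    linarith
  have h1 := hd 1
  rw [h0, mul_zero] at h1
  linear_combination h1 + h0

lemma eq_of_tendsto_recurrence {p : ℝ} (hp2 : p < 1 / 2) {ρ : ℝ}
    (hρ : ρ = p / (1 - p)) {b : ℕ → ℂ} {L : ℂ} (hL : Tendsto b atTop (𝓝 L))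
    (hb : ∀ n, b (n + 1) = p * b n + (1 - p) * b (n + 2)) :
    b 2 = ρ ^ 2 * b 0 + (1 - ρ ^ 2) * L := by
  have hqr : (1 : ℝ) - p ≠ 0 := by linarith
  have hq : (1 : ℂ) - p ≠ 0 := by exact_mod_cast hqr
  have hρc : (ρ : ℂ) * (1 - p) = p := by
    rw [hρ]; push_cast; exact div_mul_cancel₀ _ hq
  have hstep : ∀ n, b (n + 1) - ρ * b n = b 1 - ρ * b 0 := by
    intro n
    induction n with
    | zero => rfl
    | succ n ih =>
      rw [← ih]
      apply mul_left_cancel₀ hq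
      linear_combination -hb n + (b n - b (n + 1)) * hρc
  have hlim : Tendsto (fun n => b (n + 1) - ρ * b n) atTop (𝓝 (L - ρ * L)) :=
    ((tendsto_add_atTop_iff_nat 1).2 hL).sub (hL.const_mul _)
  simp only [hstep] at hlim
  have h1 := tendsto_nhds_unique tendsto_const_nhds hlim
  linear_combination hstep 1 + (ρ + 1) * h1

/-- The expectation of a bounded path functional `f` that is invariant under time shift,
multiplied by `u ^ k` under translation by `k`, and equal to `L` when the mouse never moves. -/
lemma catMouse_integral_functional {p : ℝ} (hp : 0 < p) (hp2 : p < 1 / 2) {ρ : ℝ}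
    (hρ : ρ = p / (1 - p)) {μ : ℤ × ℤ → Measure (ℕ → ℤ × ℤ)} [∀ s, IsProbabilityMeasure (μ s)]
    (hμ : IsMarkovChainLaw (catMouseKernel (freeP p)) μ) {u L : ℂ} (hu : u ≠ 0)
    {f : (ℕ → ℤ × ℤ) → ℂ} (hf : Measurable f) (hf1 : ∀ ω, ‖f ω‖ ≤ 1)
    (hcons : ∀ s ω, f (consPath s ω) = f ω)
    (hshift : ∀ k ω, f (shiftPath k ω) = u ^ k * f ω)
    (hL : ∀ ω, (∀ n, (ω n).2 = 0) → f ω = L) :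
    (∫ ω, f ω ∂μ (0, 0)) * (-(ρ : ℂ) ^ 2 * u ^ 2 + (1 + ρ) * u - 1) =
      ρ * (1 - ρ) * u ^ 2 * L := by
  have hq : 0 < 1 - p := by linarith
  have hρ0 : 0 < ρ := hρ ▸ div_pos hp hq
  have hρ1 : ρ < 1 := by rw [hρ, div_lt_one hq]; linarith
  have hsm := hf.stronglyMeasurable
  set G : ℤ × ℤ → ℂ := fun s => ∫ ω, f ω ∂μ s with hG
  have hGb : ∀ s, ‖G s‖ ≤ 1 := fun s => by
    simpa using norm_integral_le_of_norm_le_const (μ := μ s) (.of_forall hf1)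
  have hGs : ∀ x y k : ℤ, G (x + k, y + k) = u ^ k * G (x, y) := by
    intro x y k
    simp only [hG]
    rw [catMouse_map_shiftPath hμ (x, y) k,
      integral_map (measurable_shiftPath k).aemeasurable hsm.aestronglyMeasurable]
    simp only [hshift, integral_const_mul]
  have hrec : ∀ x : ℤ, x ≠ 0 → G (x, 0) = p * G (x + 1, 0) + (1 - p) * G (x - 1, 0) := by
    intro x hx
    have := catMouse_integral_of_ne hp.le (by linarith) hμ hsm hf1 hx
    simpa [hcons] using this
  have hdiag := catMouse_integral_diag hp.le (by linarith) hμ hsm hf1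
  simp only [hcons] at hdiag
  have hlim : Tendsto (fun n : ℕ => G (-(n : ℤ), 0)) atTop (𝓝 L) := by
    have hL1 : ‖L‖ ≤ 1 := by
      rw [← hL (fun _ => (0, 0)) fun _ => rfl]
      exact hf1 _
    rw [tendsto_iff_norm_sub_tendsto_zero]
    refine squeeze_zero (g := fun n => 2 * ρ ^ n) (fun _ => norm_nonneg _) (fun n => ?_)
      (by simpa using (tendsto_pow_atTop_nhds_zero_of_lt_one hρ0.le hρ1).const_mul 2)
    have hmeas : MeasurableSet {ω : ℕ → ℤ × ℤ | ∃ i, (ω i).2 ≠ 0} := by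
      have : {ω : ℕ → ℤ × ℤ | ∃ i, (ω i).2 ≠ 0} = ⋃ i, (fun ω => ω i) ⁻¹' {s | s.2 ≠ 0} := by
        ext; simp
      rw [this]
      exact .iUnion fun i => measurable_pi_apply i (Set.to_countable _).measurableSet
    have hint : Integrable f (μ (-(n : ℤ), 0)) :=
      .of_bound hsm.aestronglyMeasurable 1 (.of_forall hf1)
    have : G (-(n : ℤ), 0) - L = ∫ ω, (f ω - L) ∂μ (-(n : ℤ), 0) := by
      rw [integral_sub hint (integrable_const _)]
      simp [hG]
    rw [this]
    calc ‖∫ ω, (f ω - L) ∂μ (-(n : ℤ), 0)‖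
        ≤ ∫ ω, Set.indicator {ω | ∃ i, (ω i).2 ≠ 0} (fun _ => (2 : ℝ)) ω ∂μ (-(n : ℤ), 0) := by
          refine norm_integral_le_of_norm_le ((integrable_const _).indicator hmeas)
            (.of_forall fun ω => ?_)
          by_cases h : ∃ i, (ω i).2 ≠ 0
          · rw [Set.indicator_of_mem (by exact h)]
            exact (norm_sub_le _ _).trans (by linarith [hf1 ω])
          · rw [Set.indicator_of_notMem (by exact h), hL ω (by simpa using h)]
            simp
      _ = 2 * (μ (-(n : ℤ), 0)).real {ω | ∃ i, (ω i).2 ≠ 0} := by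
          rw [integral_indicator_const _ hmeas, smul_eq_mul, mul_comm]
      _ ≤ 2 * ρ ^ n := by
          rw [hρ]
          gcongr
          exact catMouse_measureReal_ever_moved_le hp hp2 hμ n
  have hpos := eq_of_bounded_recurrence hp hp2 (a := fun n => G ((n : ℤ), 0)) (fun n => hGb _)
    fun n => by
      have := hrec ((n + 1 : ℕ) : ℤ) (by omega)
      rwa [show ((n + 1 : ℕ) : ℤ) + 1 = ((n + 2 : ℕ) : ℤ) by push_cast; ring,
        show ((n + 1 : ℕ) : ℤ) - 1 = (n : ℤ) by push_cast; ring] at this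
  have hneg := eq_of_tendsto_recurrence hp2 hρ hlim
    fun n => by
      have := hrec (-((n + 1 : ℕ) : ℤ)) (by omega)
      rwa [show -((n + 1 : ℕ) : ℤ) + 1 = -(n : ℤ) by push_cast; ring,
        show -((n + 1 : ℕ) : ℤ) - 1 = -((n + 2 : ℕ) : ℤ) by push_cast; ring] at this
  have h11 := hGs 0 0 1
  have h1m := hGs 2 0 (-1)
  have hm1 := hGs (-2) 0 1
  have hmm := hGs 0 0 (-1)
  norm_num at h11 h1m hm1 hmm hpos hneg
  change G (0, 0) = _ • G (1, 1) + (_ • G (1, -1) + (_ • G (-1, 1) + _ • G (-1, -1))) at hdiag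
  rw [h11, h1m, hm1, hmm, hpos, hneg] at hdiag
  change G (0, 0) * _ = _
  have hp' : p = ρ / (1 + ρ) := by rw [hρ]; field_simp; ring
  have hρc : (1 + ρ : ℂ) ≠ 0 := by exact_mod_cast (by linarith : (1 + ρ : ℝ) ≠ 0)
  simp only [Complex.real_smul, hp'] at hdiag
  push_cast at hdiag
  field_simp at hdiag
  apply mul_left_cancel₀ hρc
  linear_combination hdiag

lemma generating_denominator_ne_zero {ρ : ℝ} (h0 : 0 < ρ) (h1 : ρ < 1) {u : ℂ} (hu : ‖u‖ = 1) :
    -(ρ : ℂ) ^ 2 * u ^ 2 + (1 + ρ) * u - 1 ≠ 0 := by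
  intro h
  have h2 : ((1 + ρ : ℝ) : ℂ) * u = 1 + (ρ : ℂ) ^ 2 * u ^ 2 := by
    push_cast
    linear_combination h
  have h3 := norm_add_le (1 : ℂ) ((ρ : ℂ) ^ 2 * u ^ 2)
  rw [← h2] at h3
  simp only [norm_mul, norm_pow, hu, Complex.norm_real, Real.norm_eq_abs, abs_of_pos h0,
    abs_of_pos (show 0 < 1 + ρ by linarith), norm_one] at h3
  nlinarith

/-- The mouse is eventually at rest. -/
def MouseSettles (ω : ℕ → ℤ × ℤ) : Prop := ∃ N, ∀ n ≥ N, (ω n).2 = (ω N).2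

lemma mouseLimit_eq {ω : ℕ → ℤ × ℤ} {N : ℕ} {m : ℤ} (h : ∀ n ≥ N, (ω n).2 = m) :
    mouseLimit ω = m :=
  (tendsto_const_nhds.congr' (eventually_atTop.2 ⟨N, fun n hn => (h n hn).symm⟩)).limUnder_eq

lemma mouseSettles_consPath (s : ℤ × ℤ) (ω : ℕ → ℤ × ℤ) :
    MouseSettles (consPath s ω) ↔ MouseSettles ω := by
  constructor
  · rintro ⟨N, hN⟩
    refine ⟨N, fun n hn => ?_⟩
    exact (hN (n + 1) (by omega)).trans (hN (N + 1) (by omega)).symm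
  · rintro ⟨N, hN⟩
    refine ⟨N + 1, fun n hn => ?_⟩
    obtain ⟨n, rfl⟩ : ∃ m, n = m + 1 := ⟨n - 1, by omega⟩
    exact hN n (by omega)

lemma mouseSettles_shiftPath (k : ℤ) (ω : ℕ → ℤ × ℤ) :
    MouseSettles (shiftPath k ω) ↔ MouseSettles ω := by
  simp [MouseSettles, shiftPath]

lemma mouseLimit_consPath {ω : ℕ → ℤ × ℤ} (h : MouseSettles ω) (s : ℤ × ℤ) :
    mouseLimit (consPath s ω) = mouseLimit ω := by
  obtain ⟨N, hN⟩ := h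
  rw [mouseLimit_eq hN]
  refine mouseLimit_eq (N := N + 1) fun n hn => ?_
  obtain ⟨n, rfl⟩ : ∃ m, n = m + 1 := ⟨n - 1, by omega⟩
  exact hN n (by omega)

lemma mouseLimit_shiftPath {ω : ℕ → ℤ × ℤ} (h : MouseSettles ω) (k : ℤ) :
    mouseLimit (shiftPath k ω) = k + mouseLimit ω := by
  obtain ⟨N, hN⟩ := h
  rw [mouseLimit_eq hN]
  refine mouseLimit_eq (N := N) fun n hn => ?_
  simp [shiftPath, hN n hn, add_comm]

lemma measurableSet_mouse_constant_from (N : ℕ) :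
    MeasurableSet {ω : ℕ → ℤ × ℤ | ∀ n ≥ N, (ω n).2 = (ω N).2} := by
  have : {ω : ℕ → ℤ × ℤ | ∀ n ≥ N, (ω n).2 = (ω N).2} =
      ⋂ n, ⋂ _ : n ≥ N, {ω | (ω n).2 = (ω N).2} := by
    ext; simp
  rw [this]
  exact .iInter fun n => .iInter fun _ =>
    measurableSet_eq_fun (measurable_pi_apply n).snd (measurable_pi_apply N).snd

lemma measurableSet_mouseSettles : MeasurableSet {ω | MouseSettles ω} := by
  have : {ω | MouseSettles ω} = ⋃ N, {ω : ℕ → ℤ × ℤ | ∀ n ≥ N, (ω n).2 = (ω N).2} := by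
    ext; simp [MouseSettles]
  rw [this]
  exact .iUnion measurableSet_mouse_constant_from

lemma measurable_zpow_mouseLimit (u : ℂ) :
    Measurable fun ω => if MouseSettles ω then u ^ mouseLimit ω else 0 := by
  refine measurable_of_tendsto_metrizable
    (f := fun N ω => if ∀ n ≥ N, (ω n).2 = (ω N).2 then u ^ (ω N).2 else 0)
    (fun N => Measurable.ite (measurableSet_mouse_constant_from N)
      ((measurable_of_countable fun m : ℤ => u ^ m).comp (measurable_pi_apply N).snd)
      measurable_const) (tendsto_pi_nhds.2 fun ω => ?_)
  by_cases h : MouseSettles ω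
  · obtain ⟨N, hN⟩ := id h
    refine tendsto_const_nhds.congr' (eventually_atTop.2 ⟨N, fun m hm => ?_⟩)
    beta_reduce
    rw [if_pos h, if_pos fun n hn => (hN n (by omega)).trans (hN m hm).symm,
      mouseLimit_eq hN, hN m hm]
  · refine tendsto_const_nhds.congr fun N => ?_
    rw [if_neg h, if_neg fun hN => h ⟨N, hN⟩]

lemma catMouse_ae_mouseSettles {p : ℝ} (hp : 0 < p) (hp2 : p < 1 / 2)
    {μ : ℤ × ℤ → Measure (ℕ → ℤ × ℤ)} [∀ s, IsProbabilityMeasure (μ s)]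
    (hμ : IsMarkovChainLaw (catMouseKernel (freeP p)) μ) :
    ∀ᵐ ω ∂μ (0, 0), MouseSettles ω := by
  have hq : 0 < 1 - p := by linarith
  have hρ0 : 0 < p / (1 - p) := div_pos hp hq
  have hρ1 : p / (1 - p) < 1 := by rw [div_lt_one hq]; linarith
  have hmeas := measurableSet_mouseSettles.compl
  have h := catMouse_integral_functional hp hp2 rfl hμ (u := 1) (L := 0) one_ne_zero
    (f := Set.indicator {ω | MouseSettles ω}ᶜ fun _ => 1) (measurable_const.indicator hmeas)
    (fun ω => by by_cases h : MouseSettles ω <;> simp [h])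
    (fun s ω => by simp [Set.indicator, mouseSettles_consPath])
    (fun k ω => by simp [Set.indicator, mouseSettles_shiftPath])
    (fun ω hω => by
      have : MouseSettles ω := ⟨0, fun n _ => by rw [hω, hω]⟩
      simp [this])
  rw [integral_indicator_const _ hmeas, mul_zero, mul_eq_zero] at h
  rcases h with h | h
  · rw [ae_iff]
    have h0 : (μ (0, 0)).real {ω | MouseSettles ω}ᶜ = 0 := by simpa using h
    exact (measureReal_eq_zero_iff).1 h0
  · exact absurd h (generating_denominator_ne_zero hρ0 hρ1 (by simp))

/-- For the free cat-and-mouse chain on `ℤ` driven by the `p`-random walk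
(`0 < p < 1/2`) started at `(0,0)`, the mouse moves only finitely many times a.s.,
and the final mouse location `M'_∞` has generating function
`E(u^{M'_∞}) = ρ(1-ρ)u² / (-ρ²u² + (1+ρ)u - 1)` for `u` on the unit circle. -/
theorem free_cat_mouse_final_mouse_generating_function
    (p : ℝ) (hp : 0 < p) (hp2 : p < 1 / 2) (ρ : ℝ) (hρ : ρ = p / (1 - p))
    (μ : ℤ × ℤ → Measure (ℕ → ℤ × ℤ))
    (hprob : ∀ s, IsProbabilityMeasure (μ s))
    (hμ : IsMarkovChainLaw (catMouseKernel (freeP p)) μ) :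
    (∀ᵐ ω ∂(μ (0, 0)), ∃ N : ℕ, ∀ n ≥ N, (ω n).2 = mouseLimit ω) ∧
    ∀ u : ℂ, ‖u‖ = 1 →
      ∫ ω, u ^ mouseLimit ω ∂(μ (0, 0))
        = (ρ : ℂ) * (1 - ρ) * u ^ 2
            / (-(ρ : ℂ) ^ 2 * u ^ 2 + (1 + ρ) * u - 1) := by
  have hq : 0 < 1 - p := by linarith
  have hρ0 : 0 < ρ := hρ ▸ div_pos hp hq
  have hρ1 : ρ < 1 := by rw [hρ, div_lt_one hq]; linarith
  have hae := catMouse_ae_mouseSettles hp hp2 hμ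
  constructor
  · filter_upwards [hae] with ω ⟨N, hN⟩
    exact ⟨N, fun n hn => by rw [mouseLimit_eq hN, hN n hn]⟩
  · intro u hu
    have hu0 : u ≠ 0 := by
      rintro rfl
      simp at hu
    have h := catMouse_integral_functional hp hp2 hρ hμ hu0 (L := 1)
      (f := fun ω => if MouseSettles ω then u ^ mouseLimit ω else 0)
      (measurable_zpow_mouseLimit u)
      (fun ω => by by_cases h : MouseSettles ω <;> simp [h, hu])
      (fun s ω => by
        by_cases h : MouseSettles ω <;> simp [h, mouseSettles_consPath, mouseLimit_consPath])
      (fun k ω => by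
        by_cases h : MouseSettles ω <;>
          simp [h, mouseSettles_shiftPath, mouseLimit_shiftPath, zpow_add₀ hu0])
      (fun ω hω => by
        rw [if_pos ⟨0, fun n _ => by rw [hω, hω]⟩, mouseLimit_eq (N := 0) fun n _ => hω n,
          zpow_zero])
    have hint : ∫ ω, u ^ mouseLimit ω ∂μ (0, 0) =
        ∫ ω, (if MouseSettles ω then u ^ mouseLimit ω else 0) ∂μ (0, 0) := by
      refine integral_congr_ae ?_
      filter_upwards [hae] with ω hω
      rw [if_pos hω]
    rw [hint, eq_div_iff (generating_denominator_ne_zero hρ0 hρ1 hu), h, mul_one]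
end
end
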